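/- arXiv:2007.15368 — 2 statements merged into one kernel-verified Lean document; each statement's English description precedes it below -/
import Mathlib

section
/- Let G be a finite simple graph with connected components G_1, …, G_s, s ≥ 2, and let 𝒢 = {G_i : χ(G_i) = χ(G), i ∈ [s]}. Then es_χ(G) + es_χ(complement of G) = 2 if and only if both of the following hold: (i) |𝒢| = 1 and es_χ(G_i) = 1 for the unique G_i ∈ 𝒢; (ii) either there exists a component G_j with es_χ(complement of G_j) = 1, or there exist two distinct components G_j and G_k with c*(complement of G_j) = 1 and c*(complement of G_k) = 1. -/
open Function

/-- The chromatic-stability index: the minimum number of edges whose removal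
decreases the chromatic number (0 if no such edge set exists, e.g. for edgeless graphs). -/
noncomputable def esChi {V : Type*} [Fintype V] (G : SimpleGraph V) : ℕ :=
  sInf {k | ∃ F : Finset (Sym2 V),
    ↑F ⊆ G.edgeSet ∧ F.card = k ∧
    (G.deleteEdges ↑F).chromaticNumber < G.chromaticNumber}

open scoped Classical in
/-- The color class of color `i` under the coloring `c`, as a `Finset`. -/
noncomputable def classOf {V : Type*} [Fintype V] {G : SimpleGraph V} {α : Type*}
    (c : G.Coloring α) (i : α) : Finset V :=
  Finset.univ.filter fun v => c v = i

open scoped Classical in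
/-- The number of edges of `G` with one endpoint in `A` and the other in `B`
(for disjoint `A`, `B`). -/
noncomputable def eCC {V : Type*} [Fintype V] (G : SimpleGraph V) (A B : Finset V) : ℕ :=
  ((A ×ˢ B).filter fun p => G.Adj p.1 p.2).card

/-- `c*`: the minimum size of a color class over all proper colorings of `G`
using exactly `χ(G)` colors. -/
noncomputable def cStar {V : Type*} [Fintype V] (G : SimpleGraph V) : ℕ :=
  sInf {k | ∃ (c : G.Coloring (Fin G.chromaticNumber.toNat))
      (i : Fin G.chromaticNumber.toNat),
    Surjective c ∧ k = (classOf c i).card}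

/-- The chromatic bondage number: the minimum number of edges between two distinct
color classes, over all proper colorings of `G` using exactly `χ(G)` colors. -/
noncomputable def rhoChi {V : Type*} [Fintype V] (G : SimpleGraph V) : ℕ :=
  sInf {k | ∃ (c : G.Coloring (Fin G.chromaticNumber.toNat))
      (i j : Fin G.chromaticNumber.toNat),
    Surjective c ∧ i ≠ j ∧ k = eCC G (classOf c i) (classOf c j)}

namespace SimpleGraph

variable {V : Type*} {G H K : SimpleGraph V} {A B I : Set V} {n : ℕ}

/-- `H` restricted to the vertex set `A` has a proper coloring with the colors `0, …, n - 1`. -/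
def ColorableOn (H : SimpleGraph V) (A : Set V) (n : ℕ) : Prop :=
  ∃ f : V → ℕ, (∀ x ∈ A, f x < n) ∧ ∀ x ∈ A, ∀ y ∈ A, H.Adj x y → f x ≠ f y

/-- The chromatic number of the subgraph of `H` induced by `A`, as a natural number. -/
noncomputable def chiOn (H : SimpleGraph V) (A : Set V) : ℕ :=
  (H.induce A).chromaticNumber.toNat

lemma colorableOn_iff_colorable_induce : H.ColorableOn A n ↔ (H.induce A).Colorable n := by
  classical
  constructor
  · rintro ⟨f, hf, hadj⟩
    exact ⟨Coloring.mk (fun x => ⟨f x, hf x x.2⟩) fun {x y} h he =>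
      hadj x x.2 y y.2 h (by simpa using he)⟩
  · rintro ⟨c⟩
    refine ⟨fun x => if h : x ∈ A then c ⟨x, h⟩ else 0, fun x hx => by simp [hx], ?_⟩
    intro x hx y hy h he
    simp only [hx, hy, dif_pos] at he
    exact c.valid (v := ⟨x, hx⟩) (w := ⟨y, hy⟩) h (Fin.ext he)

lemma coe_toNat_chromaticNumber [Finite V] (H : SimpleGraph V) :
    (H.chromaticNumber.toNat : ℕ∞) = H.chromaticNumber := by
  have := Fintype.ofFinite V
  exact ENat.natCast_toNat (chromaticNumber_ne_top_iff_exists.2 ⟨_, H.colorable_of_fintype⟩)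

lemma coe_chiOn [Finite V] (H : SimpleGraph V) (A : Set V) :
    (H.chiOn A : ℕ∞) = (H.induce A).chromaticNumber :=
  coe_toNat_chromaticNumber _

lemma chiOn_le_iff [Finite V] : H.chiOn A ≤ n ↔ H.ColorableOn A n := by
  rw [colorableOn_iff_colorable_induce, ← chromaticNumber_le_iff_colorable, ← coe_chiOn,
    Nat.cast_le]

lemma colorableOn_chiOn [Finite V] (H : SimpleGraph V) (A : Set V) :
    H.ColorableOn A (H.chiOn A) :=
  chiOn_le_iff.1 le_rfl

lemma coe_chiOn_univ [Finite V] (H : SimpleGraph V) :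
    (H.chiOn Set.univ : ℕ∞) = H.chromaticNumber := by
  rw [coe_chiOn]
  exact le_antisymm (chromaticNumber_mono_of_hom (induceUnivIso H).toHom)
    (chromaticNumber_mono_of_hom (induceUnivIso H).symm.toHom)

lemma chiOn_univ [Finite V] (H : SimpleGraph V) :
    H.chiOn Set.univ = H.chromaticNumber.toNat := by
  rw [← coe_chiOn_univ, ENat.toNat_natCast]

lemma chiOn_induce [Finite V] (H : SimpleGraph V) (S : Set V) (B : Set S) :
    (H.induce S).chiOn B = H.chiOn (Subtype.val '' B) := by
  classical
  apply le_antisymm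
  · obtain ⟨f, hf, hadj⟩ := H.colorableOn_chiOn (Subtype.val '' B)
    exact chiOn_le_iff.2 ⟨fun x => f x, fun x hx => hf _ ⟨x, hx, rfl⟩,
      fun x hx y hy h => hadj _ ⟨x, hx, rfl⟩ _ ⟨y, hy, rfl⟩ h⟩
  · obtain ⟨f, hf, hadj⟩ := (H.induce S).colorableOn_chiOn B
    refine chiOn_le_iff.2 ⟨fun x => if h : x ∈ S then f ⟨x, h⟩ else 0, ?_, ?_⟩
    · rintro _ ⟨x, hx, rfl⟩
      simpa using hf x hx
    · rintro _ ⟨x, hx, rfl⟩ _ ⟨y, hy, rfl⟩ h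
      simpa using hadj x hx y hy h

lemma chiOn_mono [Finite V] (h : A ⊆ B) (hK : ∀ x ∈ A, ∀ y ∈ A, K.Adj x y → H.Adj x y) :
    K.chiOn A ≤ H.chiOn B := by
  obtain ⟨f, hf, hadj⟩ := H.colorableOn_chiOn B
  exact chiOn_le_iff.2 ⟨f, fun x hx => hf x (h hx),
    fun x hx y hy hxy => hadj x (h hx) y (h hy) (hK x hx y hy hxy)⟩

lemma chiOn_congr [Finite V] (hK : ∀ x ∈ A, ∀ y ∈ A, (K.Adj x y ↔ H.Adj x y)) :
    K.chiOn A = H.chiOn A :=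
  le_antisymm (chiOn_mono le_rfl fun x hx y hy => (hK x hx y hy).1)
    (chiOn_mono le_rfl fun x hx y hy => (hK x hx y hy).2)

lemma chiOn_pos [Finite V] (h : A.Nonempty) : 0 < H.chiOn A := by
  obtain ⟨x, hx⟩ := h
  obtain ⟨f, hf, -⟩ := H.colorableOn_chiOn A
  exact (Nat.zero_le _).trans_lt (hf x hx)

/-- Deleting an independent set lowers the chromatic number by at most one. -/
lemma chiOn_le_chiOn_diff_add_one [Finite V] (hI : ∀ x ∈ I, ∀ y ∈ I, ¬ H.Adj x y) :
    H.chiOn A ≤ H.chiOn (A \ I) + 1 := by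
  classical
  obtain ⟨f, hf, hadj⟩ := H.colorableOn_chiOn (A \ I)
  refine chiOn_le_iff.2 ⟨fun x => if x ∈ I then H.chiOn (A \ I) else f x, ?_, ?_⟩
  · intro x hx
    by_cases h : x ∈ I
    · simp [h]
    · simpa [h] using (hf x ⟨hx, h⟩).trans (Nat.lt_succ_self _)
  · intro x hx y hy hxy
    by_cases h : x ∈ I <;> by_cases h' : y ∈ I
    · exact absurd hxy (hI x h y h')
    · simpa [h, h'] using (hf y ⟨hy, h'⟩).ne'
    · simpa [h, h'] using (hf x ⟨hx, h⟩).ne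
    · simpa [h, h'] using hadj x ⟨hx, h⟩ y ⟨hy, h'⟩ hxy

/-- Deleting a color class of a proper coloring saves a color. -/
lemma chiOn_diff_colorClass_add_one_le [Finite V] {f : V → ℕ} {i : ℕ} (hi : i < n)
    (hf : ∀ x ∈ A, f x < n) (hadj : ∀ x ∈ A, ∀ y ∈ A, H.Adj x y → f x ≠ f y) :
    H.chiOn (A \ {x | f x = i}) + 1 ≤ n := by
  obtain ⟨m, rfl⟩ : ∃ m, n = m + 1 := ⟨n - 1, by omega⟩
  refine Nat.succ_le_succ (chiOn_le_iff.2 ⟨fun x => if f x = m then i else f x, ?_, ?_⟩)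
  · rintro x ⟨hx, hxi⟩
    have := hf x hx
    simp only [Set.mem_ofPred_eq] at hxi ⊢
    split_ifs <;> omega
  · rintro x ⟨hx, hxi⟩ y ⟨hy, hyi⟩ hxy
    have := hadj x hx y hy hxy
    simp only [Set.mem_ofPred_eq] at hxi hyi ⊢
    split_ifs <;> omega

lemma chiOn_le_ncard_image [Finite V] {f : V → ℕ}
    (hadj : ∀ x ∈ A, ∀ y ∈ A, H.Adj x y → f x ≠ f y) : H.chiOn A ≤ (f '' A).ncard := by
  have : Fintype (f '' A) := Fintype.ofFinite _
  have c : (H.induce A).Coloring (f '' A) :=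
    Coloring.mk (fun x => ⟨f x, x, x.2, rfl⟩) fun {x y} h he =>
      hadj x x.2 y y.2 h (congrArg Subtype.val he)
  rw [chiOn_le_iff, colorableOn_iff_colorable_induce, Set.ncard_eq_toFinset_card',
    Set.toFinset_card]
  exact c.colorable

/-- The chromatic number of a join is the sum of the chromatic numbers of its parts. -/
lemma chiOn_union [Finite V] (h : ∀ x ∈ A, ∀ y ∈ B, H.Adj x y) :
    H.chiOn (A ∪ B) = H.chiOn A + H.chiOn B := by
  classical
  apply le_antisymm
  · obtain ⟨f, hf, hf'⟩ := H.colorableOn_chiOn A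
    obtain ⟨g, hg, hg'⟩ := H.colorableOn_chiOn B
    have hAB : ∀ x ∈ B, x ∉ A := fun x hB hA => (h x hA x hB).ne rfl
    refine chiOn_le_iff.2 ⟨fun x => if x ∈ A then f x else H.chiOn A + g x, ?_, ?_⟩
    · rintro x (hx | hx)
      · simpa [hx] using (hf x hx).trans_le (Nat.le_add_right _ _)
      · simpa [hAB x hx] using hg x hx
    · rintro x (hx | hx) y (hy | hy) hxy
      · simpa [hx, hy] using hf' x hx y hy hxy
      · have := hf x hx
        simp only [hx, hAB y hy, if_true, if_false]
        omega
      · have := hf y hy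
        simp only [hy, hAB x hx, if_true, if_false]
        omega
      · simpa [hAB x hx, hAB y hy] using hg' x hx y hy hxy
  · obtain ⟨f, hf, hadj⟩ := H.colorableOn_chiOn (A ∪ B)
    have hd : Disjoint (f '' A) (f '' B) := by
      rw [Set.disjoint_left]
      rintro _ ⟨x, hx, rfl⟩ ⟨y, hy, he⟩
      exact hadj x (.inl hx) y (.inr hy) (h x hx y hy) he.symm
    calc H.chiOn A + H.chiOn B ≤ (f '' A).ncard + (f '' B).ncard :=
          add_le_add
            (chiOn_le_ncard_image fun x hx y hy => hadj x (.inl hx) y (.inl hy))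
            (chiOn_le_ncard_image fun x hx y hy => hadj x (.inr hx) y (.inr hy))
      _ = (f '' (A ∪ B)).ncard := by
          rw [Set.image_union, Set.ncard_union_eq hd (Set.toFinite _) (Set.toFinite _)]
      _ ≤ (Set.Iio (H.chiOn (A ∪ B))).ncard :=
          Set.ncard_le_ncard (by rintro _ ⟨x, hx, rfl⟩; exact hf x hx) (Set.finite_Iio _)
      _ = H.chiOn (A ∪ B) := by simp [Set.ncard_eq_toFinset_card']

/-- If the restriction of `H ≤ G` to every connected component of `G` is `n`-colorable, so is
`H`. -/
lemma chiOn_univ_le_of_forall_component [Finite V] (hHG : H ≤ G)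
    (h : ∀ c : G.ConnectedComponent, H.chiOn c.supp ≤ n) : H.chiOn Set.univ ≤ n := by
  choose f hf hadj using fun c => chiOn_le_iff.1 (h c)
  refine chiOn_le_iff.2 ⟨fun x => f (G.connectedComponentMk x) x, fun x _ => hf _ x rfl, ?_⟩
  intro x _ y _ hxy
  have hc : G.connectedComponentMk y = G.connectedComponentMk x :=
    ConnectedComponent.sound (hHG hxy).symm.reachable
  simp only [hc]
  exact hadj _ x rfl y hc hxy

/-- A cross edge `uv` of a join is critical iff deleting both `u` and `v` saves two colors. -/
lemma chiOn_deleteEdges_lt_iff_of_forall_adj [Finite V] {u v : V} (huv : H.Adj u v)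
    (h : ∀ w, w ≠ u → w ≠ v → H.Adj w u ∨ H.Adj w v) :
    (H.deleteEdges {s(u, v)}).chiOn Set.univ < H.chiOn Set.univ ↔
      H.chiOn (Set.univ \ {u, v}) + 2 ≤ H.chiOn Set.univ := by
  have hK : (H.deleteEdges {s(u, v)}).chiOn (Set.univ \ {u, v}) =
      H.chiOn (Set.univ \ {u, v}) := by
    apply chiOn_congr
    rintro x ⟨-, hx⟩ y ⟨-, hy⟩
    simp only [Set.mem_insert_iff, Set.mem_singleton_iff, not_or] at hx hy
    simp [hx.1, hx.2]
  constructor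
  · intro hlt
    obtain ⟨f, hf, hadj⟩ := (H.deleteEdges {s(u, v)}).colorableOn_chiOn Set.univ
    have hfuv : f u = f v := by
      by_contra hne
      refine hlt.not_ge (chiOn_le_iff.2 ⟨f, hf, fun x hx y hy hxy he => ?_⟩)
      refine hadj x hx y hy ?_ he
      simp only [deleteEdges_adj, Set.mem_singleton_iff, hxy, true_and, Sym2.eq_iff]
      rintro (⟨rfl, rfl⟩ | ⟨rfl, rfl⟩)
      exacts [hne he, hne he.symm]
    have hclass : {x | f x = f u} ⊆ {u, v} := by
      intro w hw
      by_contra hwn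
      simp only [Set.mem_insert_iff, Set.mem_singleton_iff, not_or] at hwn
      rcases h w hwn.1 hwn.2 with hwu | hwv
      · exact hadj w trivial u trivial (by simp [hwu, hwn.1, hwn.2]) hw
      · exact hadj w trivial v trivial (by simp [hwv, hwn.1, hwn.2]) (hw.trans hfuv)
    have h₁ := chiOn_diff_colorClass_add_one_le (hf u trivial) hf hadj
    have h₂ : (H.deleteEdges {s(u, v)}).chiOn (Set.univ \ {u, v}) ≤
        (H.deleteEdges {s(u, v)}).chiOn (Set.univ \ {x | f x = f u}) :=
      chiOn_mono (Set.sdiff_subset_sdiff_right hclass) fun _ _ _ _ => id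
    omega
  · intro hle
    have := chiOn_le_chiOn_diff_add_one (H := H.deleteEdges {s(u, v)}) (A := Set.univ)
      (I := {u, v}) (by rintro x (rfl | rfl) y (rfl | rfl) <;> simp [Sym2.eq_swap])
    omega

lemma induce_deleteEdges_map_val (H : SimpleGraph V) (S : Set V) (u v : S) :
    (H.induce S).deleteEdges {s(u, v)} = (H.deleteEdges {s(u.1, v.1)}).induce S := by
  ext x y
  simp [Subtype.ext_iff]

lemma compl_induce (G : SimpleGraph V) (S : Set V) : (G.induce S)ᶜ = Gᶜ.induce S := by
  ext x y
  simp [Subtype.ext_iff]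

end SimpleGraph

open SimpleGraph

lemma esChi_eq_one_iff {V : Type*} [Fintype V] (H : SimpleGraph V) :
    esChi H = 1 ↔ ∃ u v, H.Adj u v ∧
      (H.deleteEdges {s(u, v)}).chiOn Set.univ < H.chiOn Set.univ := by
  have key : ∀ u v, (H.deleteEdges {s(u, v)}).chiOn Set.univ < H.chiOn Set.univ ↔
      (H.deleteEdges {s(u, v)}).chromaticNumber < H.chromaticNumber := fun u v => by
    rw [← coe_chiOn_univ, ← coe_chiOn_univ, Nat.cast_lt]
  unfold esChi
  constructor
  · intro h
    obtain ⟨F, hF, hcard, hlt⟩ := Nat.sInf_mem (Nat.nonempty_of_pos_sInf (by rw [h]; exact one_pos))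
    obtain ⟨e, rfl⟩ := Finset.card_eq_one.1 (hcard.trans h)
    induction e with
    | _ u v =>
      simp only [Finset.coe_singleton] at hF hlt
      exact ⟨u, v, by simpa using hF, (key u v).2 hlt⟩
  · rintro ⟨u, v, huv, hlt⟩
    have hmem : 1 ∈ {k | ∃ F : Finset (Sym2 V), ↑F ⊆ H.edgeSet ∧ F.card = k ∧
        (H.deleteEdges ↑F).chromaticNumber < H.chromaticNumber} :=
      ⟨{s(u, v)}, by simpa using huv, by simp, by simpa using (key u v).1 hlt⟩
    refine le_antisymm (Nat.sInf_le hmem) (Nat.one_le_iff_ne_zero.2 fun h0 => ?_)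
    rcases Nat.sInf_eq_zero.1 h0 with ⟨F, -, hcard, hlt⟩ | he
    · rw [Finset.card_eq_zero.1 hcard] at hlt
      simp at hlt
    · exact Set.eq_empty_iff_forall_notMem.1 he 1 hmem

lemma esChi_pos_of_adj {V : Type*} [Fintype V] {H : SimpleGraph V} {u v : V} (huv : H.Adj u v) :
    0 < esChi H := by
  classical
  unfold esChi
  refine Nat.pos_of_ne_zero fun h0 => ?_
  rcases Nat.sInf_eq_zero.1 h0 with ⟨F, -, hcard, hlt⟩ | he
  · rw [Finset.card_eq_zero.1 hcard] at hlt
    simp at hlt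
  · refine Set.eq_empty_iff_forall_notMem.1 he _
      ⟨H.edgeSet.toFinset, by simp, rfl, lt_of_le_of_lt (b := ((1 : ℕ) : ℕ∞)) ?_ ?_⟩
    · rw [chromaticNumber_le_iff_colorable, colorable_one_iff]
      simp
    · refine lt_of_not_ge fun hle => ?_
      rw [chromaticNumber_le_iff_colorable, colorable_one_iff] at hle
      rw [hle] at huv
      exact huv

lemma cStar_eq_one_iff {V : Type*} [Fintype V] [Nonempty V] (H : SimpleGraph V) :
    cStar H = 1 ↔ ∃ u, H.chiOn (Set.univ \ {u}) + 1 ≤ H.chiOn Set.univ := by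
  classical
  unfold cStar
  constructor
  · intro h
    obtain ⟨c, i, -, hc⟩ := Nat.sInf_mem (Nat.nonempty_of_pos_sInf (by rw [h]; exact one_pos))
    obtain ⟨u, hu⟩ := Finset.card_eq_one.1 (hc.symm.trans h)
    refine ⟨u, ?_⟩
    have hclass : {x | (c x : ℕ) = i} = {u} := by
      ext x
      have := Finset.ext_iff.1 hu x
      simpa [classOf, Fin.ext_iff] using this
    rw [← hclass, chiOn_univ]
    exact chiOn_diff_colorClass_add_one_le i.2 (fun x _ => (c x).2)
      fun x _ y _ hxy he => c.valid hxy (Fin.ext he)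
  · rintro ⟨u, hu⟩
    obtain ⟨f, hf, hadj⟩ := H.colorableOn_chiOn (Set.univ \ {u})
    have hlt : ∀ x, (if x = u then H.chiOn (Set.univ \ {u}) else f x) <
        H.chromaticNumber.toNat := by
      intro x
      rw [← chiOn_univ]
      split_ifs with hx
      · omega
      · exact (hf x (by simpa using hx)).trans_le (by omega)
    let c : H.Coloring (Fin H.chromaticNumber.toNat) :=
      Coloring.mk (fun x => ⟨_, hlt x⟩) fun {x y} hxy he => by
        have he := congrArg Fin.val he
        simp only at he
        by_cases hx : x = u <;> by_cases hy : y = u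
        · exact hxy.ne (hx.trans hy.symm)
        · simp only [hx, hy, if_true, if_false] at he
          exact (hf y (by simpa using hy)).ne' he
        · simp only [hx, hy, if_true, if_false] at he
          exact (hf x (by simpa using hx)).ne he
        · simp only [hx, hy, if_false] at he
          exact hadj x (by simpa using hx) y (by simpa using hy) hxy he
    have hsurj : Surjective c := by
      intro i
      by_contra hi
      push Not at hi
      have := chiOn_diff_colorClass_add_one_le (H := H) (A := Set.univ) (f := fun x => c x) i.2
        (fun x _ => (c x).2) fun x _ y _ hxy he => c.valid hxy (Fin.ext he)
      have hempty : {x | (c x : ℕ) = i} = ∅ := by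
        ext x
        simpa [Fin.ext_iff] using hi x
      rw [hempty, Set.sdiff_empty, chiOn_univ] at this
      omega
    have hcard : (classOf c (c u)).card = 1 := by
      rw [Finset.card_eq_one]
      refine ⟨u, ?_⟩
      ext x
      simp only [classOf, Finset.mem_filter, Finset.mem_univ, true_and, Finset.mem_singleton]
      refine ⟨fun hx => ?_, fun hx => by rw [hx]⟩
      by_contra hne
      have hx : (if x = u then H.chiOn (Set.univ \ {u}) else f x) =
        (if u = u then H.chiOn (Set.univ \ {u}) else f u) := congrArg Fin.val hx
      simp only [hne, if_true, if_false] at hx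
      exact (hf x (by simpa using hne)).ne hx
    have hmem : 1 ∈ {k | ∃ (c : H.Coloring (Fin H.chromaticNumber.toNat))
        (i : Fin H.chromaticNumber.toNat), Surjective c ∧ k = (classOf c i).card} :=
      ⟨c, c u, hsurj, hcard.symm⟩
    refine le_antisymm (Nat.sInf_le hmem) (Nat.one_le_iff_ne_zero.2 fun h0 => ?_)
    rcases Nat.sInf_eq_zero.1 h0 with ⟨c', i, hs, h⟩ | he
    · obtain ⟨x, hx⟩ := hs i
      have : x ∈ classOf c' i := by simp [classOf, hx]
      rw [Finset.card_eq_zero.1 h.symm] at this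
      exact absurd this (Finset.notMem_empty x)
    · exact Set.eq_empty_iff_forall_notMem.1 he 1 hmem

lemma esChi_induce_eq_one_iff {V : Type*} [Finite V] (H : SimpleGraph V) (S : Set V)
    [Fintype S] :
    esChi (H.induce S) = 1 ↔ ∃ u ∈ S, ∃ v ∈ S, H.Adj u v ∧
      (H.deleteEdges {s(u, v)}).chiOn S < H.chiOn S := by
  rw [esChi_eq_one_iff]
  simp only [induce_deleteEdges_map_val, chiOn_induce, Set.image_univ, Subtype.range_coe,
    Subtype.exists, comap_adj]
  tauto

lemma cStar_induce_eq_one_iff {V : Type*} [Finite V] (H : SimpleGraph V) (S : Set V)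
    [Fintype S] [Nonempty S] :
    cStar (H.induce S) = 1 ↔ ∃ u ∈ S, H.chiOn (S \ {u}) + 1 ≤ H.chiOn S := by
  rw [cStar_eq_one_iff]
  simp only [chiOn_induce, Set.image_univ, Subtype.range_coe, Subtype.exists,
    Set.image_sdiff Subtype.val_injective, Set.image_singleton, exists_prop]

lemma esChi_eq_one_iff_component {V : Type*} [Fintype V] (G : SimpleGraph V) :
    esChi G = 1 ↔ ∃ c : G.ConnectedComponent,
      (∀ d : G.ConnectedComponent, d ≠ c → G.chiOn d.supp < G.chiOn Set.univ) ∧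
      G.chiOn c.supp = G.chiOn Set.univ ∧
      ∃ u ∈ c.supp, ∃ v ∈ c.supp, G.Adj u v ∧
        (G.deleteEdges {s(u, v)}).chiOn c.supp < G.chiOn c.supp := by
  have hsub : ∀ (H : SimpleGraph V) (S : Set V), H.chiOn S ≤ H.chiOn Set.univ := fun H S =>
    chiOn_mono (Set.subset_univ S) fun _ _ _ _ => id
  have hdel : ∀ {u v : V} {c d : G.ConnectedComponent}, u ∈ c.supp → d ≠ c →
      (G.deleteEdges {s(u, v)}).chiOn d.supp = G.chiOn d.supp := by
    intro u v c d hu hd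
    apply chiOn_congr
    intro x hx y hy
    have hxu : x ≠ u := fun h => hd (hx.symm.trans (h ▸ hu))
    have hyu : y ≠ u := fun h => hd (hy.symm.trans (h ▸ hu))
    simp [hxu, hyu]
  rw [esChi_eq_one_iff]
  constructor
  · rintro ⟨u, v, huv, hlt⟩
    have hother : ∀ d, d ≠ G.connectedComponentMk u → G.chiOn d.supp < G.chiOn Set.univ :=
      fun d hd => by
        rw [← hdel (v := v) (rfl : u ∈ (G.connectedComponentMk u).supp) hd]
        exact (hsub _ _).trans_lt hlt
    have hc : G.chiOn (G.connectedComponentMk u).supp = G.chiOn Set.univ := by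
      by_contra hne
      have hle : G.chiOn Set.univ ≤ G.chiOn Set.univ - 1 :=
        chiOn_univ_le_of_forall_component (G := G) le_rfl fun d => by
          by_cases hd : d = G.connectedComponentMk u
          · have := hsub G d.supp
            subst hd
            omega
          · have := hother d hd
            omega
      omega
    exact ⟨G.connectedComponentMk u, hother, hc, u, rfl, v,
      ConnectedComponent.sound huv.symm.reachable, huv, hc.symm ▸ (hsub _ _).trans_lt hlt⟩
  · rintro ⟨c, hother, hc, u, hu, v, hv, huv, hlt⟩
    refine ⟨u, v, huv, ?_⟩
    have hle : (G.deleteEdges {s(u, v)}).chiOn Set.univ ≤ G.chiOn Set.univ - 1 :=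
      chiOn_univ_le_of_forall_component (G := G) (deleteEdges_le _) fun d => by
        by_cases hd : d = c
        · subst hd
          omega
        · have := hother d hd
          rw [hdel hu hd]
          omega
    omega

lemma esChi_compl_eq_one_iff_component {V : Type*} [Fintype V] (G : SimpleGraph V) :
    esChi Gᶜ = 1 ↔
      (∃ c : G.ConnectedComponent, ∃ u ∈ c.supp, ∃ v ∈ c.supp, Gᶜ.Adj u v ∧
        (Gᶜ.deleteEdges {s(u, v)}).chiOn c.supp < Gᶜ.chiOn c.supp) ∨
      ∃ c d : G.ConnectedComponent, c ≠ d ∧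
        (∃ u ∈ c.supp, Gᶜ.chiOn (c.supp \ {u}) + 1 ≤ Gᶜ.chiOn c.supp) ∧
        ∃ v ∈ d.supp, Gᶜ.chiOn (d.supp \ {v}) + 1 ≤ Gᶜ.chiOn d.supp := by
  have hjoin : ∀ {x y : V} {c : G.ConnectedComponent}, x ∈ c.supp → y ∉ c.supp → Gᶜ.Adj x y := by
    intro x y c hx hy
    rw [compl_adj]
    exact ⟨fun h => hy (h ▸ hx),
      fun h => hy ((ConnectedComponent.sound h.symm.reachable).trans hx)⟩
  have hinner : ∀ {c : G.ConnectedComponent} {u v : V}, u ∈ c.supp → v ∈ c.supp →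
      ((Gᶜ.deleteEdges {s(u, v)}).chiOn Set.univ < Gᶜ.chiOn Set.univ ↔
        (Gᶜ.deleteEdges {s(u, v)}).chiOn c.supp < Gᶜ.chiOn c.supp) := by
    intro c u v hu hv
    have hne : ∀ x ∈ c.suppᶜ, x ≠ u ∧ x ≠ v := fun x hx =>
      ⟨fun h => hx (h ▸ hu), fun h => hx (h ▸ hv)⟩
    rw [← Set.union_compl_self c.supp, chiOn_union (H := Gᶜ) (B := c.suppᶜ) fun x hx y hy => hjoin hx hy,
      chiOn_union (H := Gᶜ.deleteEdges {s(u, v)}) (B := c.suppᶜ) fun x hx y hy => by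
        have := hjoin hx hy
        simp only [deleteEdges_adj, this, Set.mem_singleton_iff, true_and]
        simp [(hne y hy).1, (hne y hy).2],
      chiOn_congr (K := Gᶜ.deleteEdges {s(u, v)}) (H := Gᶜ) (A := c.suppᶜ) fun x hx y hy => by
        simp [(hne x hx).1, (hne x hx).2]]
    omega
  have hcross : ∀ {c d : G.ConnectedComponent} {u v : V}, c ≠ d → u ∈ c.supp → v ∈ d.supp →
      ((Gᶜ.deleteEdges {s(u, v)}).chiOn Set.univ < Gᶜ.chiOn Set.univ ↔
        Gᶜ.chiOn (c.supp \ {u}) + 1 ≤ Gᶜ.chiOn c.supp ∧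
        Gᶜ.chiOn (d.supp \ {v}) + 1 ≤ Gᶜ.chiOn d.supp) := by
    intro c d u v hcd hu hv
    have hdc : ∀ {x}, x ∈ d.supp → x ∉ c.supp := fun h h' => hcd (h'.symm.trans h)
    have hsplit : ∀ C ⊆ c.supp, ∀ D ⊆ d.supp, Gᶜ.chiOn (C ∪ (D ∪ (c.supp ∪ d.supp)ᶜ)) =
        Gᶜ.chiOn C + (Gᶜ.chiOn D + Gᶜ.chiOn (c.supp ∪ d.supp)ᶜ) := by
      intro C hC D hD
      rw [chiOn_union (A := C), chiOn_union (A := D)]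
      · exact fun x hx y hy => hjoin (hD hx) fun h => hy (.inr h)
      · rintro x hx y (hy | hy)
        exacts [hjoin (hC hx) (hdc (hD hy)), hjoin (hC hx) fun h => hy (.inl h)]
    have huniv : Set.univ = c.supp ∪ (d.supp ∪ (c.supp ∪ d.supp)ᶜ) := by
      ext x
      simp only [Set.mem_univ, Set.mem_union, Set.mem_compl_iff, true_iff]
      tauto
    have hdiff : Set.univ \ {u, v} =
        c.supp \ {u} ∪ (d.supp \ {v} ∪ (c.supp ∪ d.supp)ᶜ) := by
      ext x
      have h₁ : x ∈ d.supp → x ≠ u := fun h h' => hdc h (h' ▸ hu)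
      have h₂ : x ∈ c.supp → x ≠ v := fun h h' => hdc (h' ▸ hv) h
      have h₃ : x = u → x ∈ c.supp := fun h => h ▸ hu
      have h₄ : x = v → x ∈ d.supp := fun h => h ▸ hv
      simp only [Set.mem_univ, Set.mem_union, Set.mem_compl_iff, Set.mem_sdiff, true_and,
        Set.mem_insert_iff, Set.mem_singleton_iff]
      tauto
    rw [chiOn_deleteEdges_lt_iff_of_forall_adj (hjoin hu (hdc hv)) ?_, hdiff, huniv,
      hsplit _ le_rfl _ le_rfl, hsplit _ Set.sdiff_subset _ Set.sdiff_subset]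
    · have hu' := chiOn_le_chiOn_diff_add_one (H := Gᶜ) (A := c.supp) (I := {u}) (by simp)
      have hv' := chiOn_le_chiOn_diff_add_one (H := Gᶜ) (A := d.supp) (I := {v}) (by simp)
      omega
    · intro w _ _
      by_cases hw : w ∈ c.supp
      · exact .inr (hjoin hw (hdc hv))
      · exact .inl (hjoin hu hw).symm
  rw [esChi_eq_one_iff]
  constructor
  · rintro ⟨u, v, huv, hlt⟩
    by_cases hc : G.connectedComponentMk u = G.connectedComponentMk v
    · exact .inl ⟨_, u, hc, v, rfl, huv, (hinner hc rfl).1 hlt⟩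
    · obtain ⟨h₁, h₂⟩ := (hcross hc rfl rfl).1 hlt
      exact .inr ⟨_, _, hc, ⟨u, rfl, h₁⟩, v, rfl, h₂⟩
  · rintro (⟨c, u, hu, v, hv, huv, hlt⟩ | ⟨c, d, hcd, ⟨u, hu, h₁⟩, v, hv, h₂⟩)
    · exact ⟨u, v, huv, (hinner hu hv).2 hlt⟩
    · exact ⟨u, v, hjoin hu fun h => hcd (h.symm.trans hv), (hcross hcd hu hv).2 ⟨h₁, h₂⟩⟩

open scoped Classical in
/-- For a disconnected graph `G` (at least two connected components),
`es_χ(G) + es_χ(Ḡ) = 2` iff (i) exactly one component has the same chromatic number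
as `G` and that component has `es_χ = 1`, and (ii) some component `G_j` has
`es_χ(complement of G_j) = 1`, or two distinct components `G_j, G_k` have
`c*(complement of G_j) = c*(complement of G_k) = 1`. -/
theorem esChi_add_esChi_compl_eq_two_disconnected {V : Type*} [Fintype V]
    (G : SimpleGraph V) (hs : ∃ c₁ c₂ : G.ConnectedComponent, c₁ ≠ c₂) :
    esChi G + esChi Gᶜ = 2 ↔
      (((∃! c : G.ConnectedComponent,
          (G.induce c.supp).chromaticNumber = G.chromaticNumber) ∧
        (∀ c : G.ConnectedComponent,
          (G.induce c.supp).chromaticNumber = G.chromaticNumber →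
          esChi (G.induce c.supp) = 1)) ∧
       ((∃ c : G.ConnectedComponent, esChi ((G.induce c.supp)ᶜ) = 1) ∨
        (∃ c c' : G.ConnectedComponent, c ≠ c' ∧
          cStar ((G.induce c.supp)ᶜ) = 1 ∧ cStar ((G.induce c'.supp)ᶜ) = 1))) := by
  have hchi : ∀ c : G.ConnectedComponent,
      (G.induce c.supp).chromaticNumber = G.chromaticNumber ↔
        G.chiOn c.supp = G.chiOn Set.univ := fun c => by
    rw [← coe_chiOn, ← coe_chiOn_univ, Nat.cast_inj]
  have hle : ∀ c : G.ConnectedComponent, G.chiOn c.supp ≤ G.chiOn Set.univ := fun c =>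
    chiOn_mono (Set.subset_univ _) fun _ _ _ _ => id
  have hne : ∀ c : G.ConnectedComponent, Nonempty c.supp := fun c =>
    c.nonempty_supp.to_subtype
  have hsum : esChi G + esChi Gᶜ = 2 ↔ esChi G = 1 ∧ esChi Gᶜ = 1 := by
    refine ⟨fun h => ?_, fun h => by omega⟩
    have hcompl : esChi Gᶜ ≠ 0 := by
      obtain ⟨c, d, hcd⟩ := hs
      obtain ⟨u, rfl⟩ := c.exists_rep
      obtain ⟨v, rfl⟩ := d.exists_rep
      exact (esChi_pos_of_adj (H := Gᶜ) (u := u) (v := v) ((compl_adj ..).2 ⟨fun h => hcd (by rw [h]),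
        fun h => hcd (ConnectedComponent.sound h.reachable)⟩)).ne'
    by_cases hG : ∃ u v, G.Adj u v
    · obtain ⟨u, v, huv⟩ := hG
      have := esChi_pos_of_adj huv
      omega
    · have hsupp : ∀ c : G.ConnectedComponent,
          ∃ u ∈ c.supp, Gᶜ.chiOn (c.supp \ {u}) + 1 ≤ Gᶜ.chiOn c.supp := by
        intro c
        obtain ⟨u, hu⟩ := c.nonempty_supp
        have hbot : G = ⊥ := by
          ext x y
          simpa using fun hxy => hG ⟨x, y, hxy⟩
        have hc : c.supp \ {u} = ∅ := by
          rw [Set.sdiff_eq_empty]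
          intro x hx
          have hr : G.Reachable x u := ConnectedComponent.exact (hx.trans hu.symm)
          rwa [hbot, reachable_bot] at hr
        have hzero : Gᶜ.chiOn ∅ ≤ 0 :=
          chiOn_le_iff.2 ⟨fun _ => 0, by simp, by simp⟩
        have hpos := chiOn_pos (H := Gᶜ) c.nonempty_supp
        refine ⟨u, hu, ?_⟩
        rw [hc]
        omega
      obtain ⟨c, d, hcd⟩ := hs
      have := (esChi_compl_eq_one_iff_component G).2 (.inr ⟨c, d, hcd, hsupp c, hsupp d⟩)
      omega
  rw [hsum, esChi_eq_one_iff_component, esChi_compl_eq_one_iff_component]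
  simp only [compl_induce, hchi, esChi_induce_eq_one_iff, cStar_induce_eq_one_iff]
  refine and_congr_left fun _ => ⟨?_, ?_⟩
  · rintro ⟨c, hother, hc, he⟩
    have huniq : ∀ d : G.ConnectedComponent, G.chiOn d.supp = G.chiOn Set.univ → d = c :=
      fun d hd => by_contra fun h => (hother d h).ne hd
    exact ⟨⟨c, hc, huniq⟩, fun d hd => huniq d hd ▸ he⟩
  · rintro ⟨⟨c, hc, huniq⟩, he⟩
    exact ⟨c, fun d hd => lt_of_le_of_ne (hle d) fun h => hd (huniq d h), hc, he c hc⟩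
end

section
/- Let G be a finite simple graph of order n with n ≡ 2 (mod 3) and χ(G) = 3. Suppose that for every proper coloring of G with exactly three color classes C_1, C_2, C_3 ordered so that |C_1| ≤ |C_2| ≤ |C_3|, the following all hold: (1) |C_1| = ⌊n/3⌋ and |C_2| = |C_3| = ⌊n/3⌋ + 1; (2) for i ∈ {2, 3}, the subgraph of G induced by C_1 ∪ C_i is a complete bipartite graph with bipartition (C_1, C_i); (3) for every i, every v ∈ C_i and every j ∈ {1, 2, 3} \ {i}, the number of edges from v to C_j is at least ⌊n/3⌋. Then es_χ(G) = ⌊n/3⌋·(⌊n/3⌋ + 1). -/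
open Function

namespace SimpleGraph

variable {V : Type*} {G : SimpleGraph V}

lemma mem_classOf [Fintype V] {α : Type*} {c : G.Coloring α} {i : α} {v : V} :
    v ∈ classOf c i ↔ c v = i := by
  simp [classOf]

/-- Two non-neighbours of `v` in a set of size at most `m + 1` coincide if `v` sends at least `m`
edges to that set. -/
lemma eq_of_not_adj_of_le_eCC [Fintype V] {m : ℕ} {v x y : V} {B : Finset V} (hB : B.card ≤ m + 1)
    (hv : m ≤ eCC G {v} B) (hx : x ∈ B) (hy : y ∈ B) (hvx : ¬G.Adj v x) (hvy : ¬G.Adj v y) :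
    x = y := by
  classical
  by_contra hxy
  have hsub : (({v} ×ˢ B).filter fun p ↦ G.Adj p.1 p.2) ⊆
      {v} ×ˢ ((B.erase x).erase y) := by
    rintro ⟨a, b⟩ h
    simp only [Finset.mem_filter, Finset.mem_product, Finset.mem_singleton] at h
    obtain ⟨⟨rfl, hb⟩, hab⟩ := h
    simp only [Finset.mem_product, Finset.mem_singleton, Finset.mem_erase]
    exact ⟨trivial, fun h ↦ hvy (h ▸ hab), fun h ↦ hvx (h ▸ hab), hb⟩
  have hle : eCC G {v} B ≤ ((B.erase x).erase y).card := by
    have := Finset.card_le_card hsub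
    rw [Finset.card_product, Finset.card_singleton, one_mul] at this
    unfold eCC
    convert this
  have hyx : y ∈ B.erase x := Finset.mem_erase.2 ⟨Ne.symm hxy, hy⟩
  have h₁ := Finset.card_erase_add_one hyx
  have h₂ := Finset.card_erase_add_one hx
  omega

/-- If every vertex of `B` (resp. `C`) has at most one non-neighbour in the equally large set `C`
(resp. `B`), then the non-edges between `B` and `C` are contained in a perfect matching. -/
lemma exists_equiv_adj_of_ne {B C : Finset V} (hcard : B.card = C.card)
    (hB : ∀ b ∈ B, ∀ x ∈ C, ∀ y ∈ C, ¬G.Adj b x → ¬G.Adj b y → x = y)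
    (hC : ∀ c ∈ C, ∀ x ∈ B, ∀ y ∈ B, ¬G.Adj c x → ¬G.Adj c y → x = y) :
    ∃ e : B ≃ C, ∀ b c, c ≠ e b → G.Adj b c := by
  classical
  let s : Set B := {b | ∃ c ∈ C, ¬G.Adj b c}
  let f : B → V := fun b ↦ if h : ∃ c ∈ C, ¬G.Adj b c then h.choose else b
  have hf : ∀ b ∈ s, f b ∈ C ∧ ¬G.Adj b (f b) := by
    intro b hb
    have hb' : ∃ c ∈ C, ¬G.Adj b c := hb
    simp only [f, dif_pos hb']
    exact hb'.choose_spec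
  have hinj : Set.InjOn f s := by
    intro x hx y hy hxy
    obtain ⟨h₁, h₂⟩ := hf x hx
    obtain ⟨-, h₃⟩ := hf y hy
    rw [← hxy] at h₃
    exact Subtype.ext (hC _ h₁ _ x.2 _ y.2 (fun h ↦ h₂ h.symm) fun h ↦ h₃ h.symm)
  obtain ⟨e, he⟩ := Set.MapsTo.exists_equiv_extend_of_card_eq
    (by simpa using hcard) (fun b hb ↦ (hf b hb).1) hinj
  refine ⟨e, fun b c hc ↦ by_contra fun hbc ↦ hc ?_⟩
  have hb : b ∈ s := ⟨c, c.2, hbc⟩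
  refine Subtype.ext (hB b b.2 _ c.2 _ (e b).2 hbc ?_)
  rw [he b hb]
  exact (hf b hb).2

/-- Deleting edges so that the chromatic number drops below three hits every triangle. -/
lemma mem_of_chromaticNumber_deleteEdges_lt {F : Set (Sym2 V)}
    (hF : (G.deleteEdges F).chromaticNumber < 3) {x y z : V}
    (hxy : G.Adj x y) (hxz : G.Adj x z) (hyz : G.Adj y z) :
    s(x, y) ∈ F ∨ s(x, z) ∈ F ∨ s(y, z) ∈ F := by
  classical
  by_contra! h
  refine cliqueFree_of_chromaticNumber_lt (n := 3) hF {x, y, z} ?_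
  rw [is3Clique_triple_iff]
  simp [*]

/-- A cyclic packing of `m * (m + 1)` edge-disjoint triangles bounds from below any edge set
whose deletion makes the graph bipartite. -/
lemma mul_le_card_of_chromaticNumber_deleteEdges_lt {m : ℕ} (col : V → Fin 3)
    {a : {k : ZMod (m + 1) // k ≠ 0} → V} {b c : ZMod (m + 1) → V}
    (ha : Injective a) (hb : Injective b) (hc : Injective c)
    (ha' : ∀ k, col (a k) = 0) (hb' : ∀ i, col (b i) = 1) (hc' : ∀ i, col (c i) = 2)
    (hab : ∀ k i, G.Adj (a k) (b i)) (hac : ∀ k i, G.Adj (a k) (c i))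
    (hbc : ∀ i j, i ≠ j → G.Adj (b i) (c j))
    {F : Finset (Sym2 V)} (hF : (G.deleteEdges (F : Set (Sym2 V))).chromaticNumber < 3) :
    m * (m + 1) ≤ F.card := by
  classical
  have key (p : {k : ZMod (m + 1) // k ≠ 0} × ZMod (m + 1)) : ∃ e ∈ F,
      e = s(a p.1, b p.2) ∨ e = s(a p.1, c (p.2 + p.1)) ∨ e = s(b p.2, c (p.2 + p.1)) := by
    have := mem_of_chromaticNumber_deleteEdges_lt hF (hab p.1 p.2) (hac p.1 (p.2 + p.1))
      (hbc p.2 (p.2 + p.1) (by simpa using p.1.2))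
    simp only [Finset.mem_coe] at this
    grind
  choose g hgF hg using key
  have hinj : Injective g := by
    intro p q hpq
    have hne₁ : ∀ k i, a k ≠ b i := fun k i h ↦ by simpa [ha', hb'] using congrArg col h
    have hne₂ : ∀ k i, a k ≠ c i := fun k i h ↦ by simpa [ha', hc'] using congrArg col h
    have hne₃ : ∀ k i, b k ≠ c i := fun k i h ↦ by simpa [hb', hc'] using congrArg col h
    have hp := hg p
    have hq := hg q
    rw [hpq] at hp
    obtain ⟨k, i⟩ := p
    obtain ⟨l, j⟩ := q
    rcases hp with hp | hp | hp <;> rcases hq with hq | hq | hq <;>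
      rw [hp] at hq <;>
      simp only [Sym2.eq_iff, hne₁, hne₂, hne₃, (hne₁ _ _).symm, (hne₂ _ _).symm,
        (hne₃ _ _).symm, ha.eq_iff, hb.eq_iff, hc.eq_iff, false_and, and_false, or_false] at hq <;>
      obtain ⟨rfl, h⟩ := hq <;>
      simp_all [Subtype.ext_iff]
  have hcard := Finset.card_le_card_of_injOn (s := Finset.univ) g (fun p _ ↦ hgF p) hinj.injOn
  have hk : Fintype.card {k : ZMod (m + 1) // k ≠ 0} = m := by
    rw [Fintype.card_subtype_compl, ZMod.card, Fintype.card_subtype_eq]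
    simp
  rwa [Finset.card_univ, Fintype.card_prod, hk, ZMod.card] at hcard

/-- The edges between two color classes of a 3-coloring decrease the chromatic number below
three when deleted. -/
lemma chromaticNumber_deleteEdges_lt_three (c : G.Coloring (Fin 3)) {F : Set (Sym2 V)}
    (hF : ∀ u v, G.Adj u v → c u = 0 → c v = 1 → s(u, v) ∈ F) :
    (G.deleteEdges F).chromaticNumber < 3 := by
  have hcol : (G.deleteEdges F).Colorable 2 := by
    refine ⟨Coloring.mk (fun v ↦ if c v = 2 then (1 : Fin 2) else 0) fun {u v} huv ↦ ?_⟩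
    rw [deleteEdges_adj] at huv
    have hne := c.valid huv.1
    have h₁ := hF u v huv.1
    have h₂ := hF v u huv.1.symm
    rw [Sym2.eq_swap] at h₂
    have h₃ := huv.2
    generalize c u = x at *
    generalize c v = y at *
    fin_cases x <;> fin_cases y <;> simp_all
  exact lt_of_le_of_lt hcol.chromaticNumber_le (by norm_num)

/-- Colors can be permuted so that the class sizes are nondecreasing. -/
lemma Coloring.exists_surjective_card_classOf_le [Fintype V] {n : ℕ} (c : G.Coloring (Fin n))
    (hc : Surjective c) : ∃ c' : G.Coloring (Fin n), Surjective c' ∧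
      ∀ i j, i ≤ j → (classOf c' i).card ≤ (classOf c' j).card := by
  let f : Fin n → ℕ := fun i ↦ (classOf c i).card
  let σ := Tuple.sort f
  refine ⟨Coloring.mk (fun v ↦ σ.symm (c v)) fun h e ↦ c.valid h (σ.symm.injective e),
    σ.symm.surjective.comp hc, fun i j hij ↦ ?_⟩
  have hcl : ∀ i, classOf (Coloring.mk (fun v ↦ σ.symm (c v))
      fun h e ↦ c.valid h (σ.symm.injective e)) i = classOf c (σ i) := by
    intro i
    ext v
    rw [mem_classOf, mem_classOf]
    exact σ.symm_apply_eq
  rw [hcl, hcl]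
  exact Tuple.monotone_sort f hij

end SimpleGraph

open SimpleGraph in

/-- Let `G` have order `n ≡ 2 (mod 3)` and `χ(G) = 3`. If every proper
coloring of `G` with exactly three color classes, ordered by nondecreasing size,
satisfies conditions (1)-(3) (sizes `⌊n/3⌋, ⌊n/3⌋+1, ⌊n/3⌋+1`; `C₁ ∪ C_i` induces a
complete bipartite graph with bipartition `(C₁, C_i)` for `i ∈ {2,3}`; every vertex
sends at least `⌊n/3⌋` edges to each other class), then
`es_χ(G) = ⌊n/3⌋·(⌊n/3⌋ + 1)`. -/
theorem esChi_attains_bound_of_conditions {V : Type*} [Fintype V]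
    (G : SimpleGraph V) (hmod : Fintype.card V % 3 = 2)
    (hchi : G.chromaticNumber = 3)
    (hyp : ∀ c : G.Coloring (Fin 3), Surjective c →
      (∀ i j : Fin 3, i ≤ j → (classOf c i).card ≤ (classOf c j).card) →
      ((classOf c (0 : Fin 3)).card = Fintype.card V / 3 ∧
       (∀ i : Fin 3, i ≠ 0 → (classOf c i).card = Fintype.card V / 3 + 1) ∧
       (∀ i : Fin 3, i ≠ 0 → ∀ u v : V,
         (u ∈ classOf c (0 : Fin 3) ∨ u ∈ classOf c i) →
         (v ∈ classOf c (0 : Fin 3) ∨ v ∈ classOf c i) →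
         (G.Adj u v ↔
           ((u ∈ classOf c (0 : Fin 3) ∧ v ∈ classOf c i) ∨
            (u ∈ classOf c i ∧ v ∈ classOf c (0 : Fin 3))))) ∧
       (∀ (i : Fin 3) (v : V), v ∈ classOf c i → ∀ j : Fin 3, j ≠ i →
         Fintype.card V / 3 ≤ eCC G {v} (classOf c j)))) :
    esChi G = (Fintype.card V / 3) * (Fintype.card V / 3 + 1) := by
  classical
  have hcol : G.Colorable 3 := chromaticNumber_le_iff_colorable.1 hchi.le
  obtain ⟨c₀⟩ := id hcol
  obtain ⟨c, hc, hmono⟩ := Coloring.exists_surjective_card_classOf_le c₀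
    ((chromaticNumber_eq_iff_forall_surjective hcol).1 hchi c₀)
  obtain ⟨hA, hBC, hadj, hdeg⟩ := hyp c hc hmono
  set m := Fintype.card V / 3
  have hB := hBC 1 (by decide)
  have hC := hBC 2 (by decide)
  simp only [mem_classOf] at hadj hdeg
  have hjoin : ∀ u v, c u = 0 → c v ≠ 0 → G.Adj u v := fun u v hu hv ↦
    (hadj (c v) hv u v (Or.inl hu) (Or.inr rfl)).2 (Or.inl ⟨hu, rfl⟩)
  let F : Finset (Sym2 V) := (classOf c 0 ×ˢ classOf c 1).image fun p ↦ s(p.1, p.2)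
  have hFcard : F.card = m * (m + 1) := by
    rw [Finset.card_image_of_injOn, Finset.card_product, hA, hB]
    rintro ⟨u, v⟩ h ⟨u', v'⟩ h' e
    simp only [Finset.coe_product, Set.mem_prod, Finset.mem_coe, mem_classOf] at h h'
    simp only [Sym2.eq_iff] at e
    rcases e with ⟨rfl, rfl⟩ | ⟨rfl, rfl⟩
    · rfl
    · simp_all
  refine le_antisymm (Nat.sInf_le ⟨F, ?_, hFcard, ?_⟩) (le_csInf ⟨_, F, ?_, hFcard, ?_⟩ ?_)
  case refine_1 | refine_3 =>
    intro e he
    simp only [F, Finset.coe_image, Set.mem_image, Finset.mem_coe, Finset.mem_product,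
      mem_classOf] at he
    obtain ⟨⟨u, v⟩, ⟨hu, hv⟩, rfl⟩ := he
    exact hjoin u v hu (by simp_all)
  case refine_2 | refine_4 =>
    rw [hchi]
    refine chromaticNumber_deleteEdges_lt_three c fun u v _ hu hv ↦ ?_
    exact Finset.mem_coe.2 (Finset.mem_image.2 ⟨(u, v), by simp [mem_classOf, hu, hv], rfl⟩)
  rintro k ⟨E, -, rfl, hE⟩
  rw [hchi] at hE
  obtain ⟨e, he⟩ := exists_equiv_adj_of_ne (G := G) (hB.trans hC.symm)
    (fun b hb x hx y hy ↦ eq_of_not_adj_of_le_eCC hC.le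
      (hdeg 1 b (mem_classOf.1 hb) 2 (by decide)) hx hy)
    (fun b hb x hx y hy ↦ eq_of_not_adj_of_le_eCC hB.le
      (hdeg 2 b (mem_classOf.1 hb) 1 (by decide)) hx hy)
  have eA : {k : ZMod (m + 1) // k ≠ 0} ≃ classOf c 0 := Fintype.equivOfCardEq (by
    rw [Fintype.card_subtype_compl, ZMod.card, Fintype.card_subtype_eq, Fintype.card_coe, hA]
    simp)
  have eB : ZMod (m + 1) ≃ classOf c 1 := Fintype.equivOfCardEq (by
    rw [ZMod.card, Fintype.card_coe, hB])
  have hmemA k : c (eA k) = 0 := mem_classOf.1 (eA k).2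
  have hmemB i : c (eB i) = 1 := mem_classOf.1 (eB i).2
  have hmemC i : c (e (eB i)) = 2 := mem_classOf.1 (e (eB i)).2
  exact mul_le_card_of_chromaticNumber_deleteEdges_lt c
    (a := fun k ↦ eA k) (b := fun i ↦ eB i) (c := fun i ↦ e (eB i))
    (Subtype.val_injective.comp eA.injective) (Subtype.val_injective.comp eB.injective)
    (Subtype.val_injective.comp (e.injective.comp eB.injective)) hmemA hmemB hmemC
    (fun k i ↦ hjoin _ _ (hmemA k) (by simp [hmemB]))
    (fun k i ↦ hjoin _ _ (hmemA k) (by simp [hmemC]))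
    (fun i j hij ↦ he _ _ fun h ↦ hij (eB.injective (e.injective h)).symm) hE
end
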